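/- arXiv:1503.00650 — 2 statements merged into one kernel-verified Lean document; each statement's English description precedes it below -/
import Mathlib

section
/- Let k_1, …, k_m be integers each at least 2 such that no k_i divides k_j for i ≠ j. Then there is NO first-order sentence φ in the language with a single binary relation symbol such that for every finite structure in this language, with underlying set V and interpreted relation R, the structure satisfies φ if and only if every repair of R contains, for each i ∈ {1,…,m}, a closed walk of length k_i. (Consistent answering of a disjoint collection of cycles of lengths at least 2 is not first-order rewritable; in particular this holds for a single n-cycle with n ≥ 2.) -/
open FirstOrder

/-- A relation is consistent (satisfies the key constraint on the first attribute)
if it is functional. -/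
def Consistent {V : Type*} (R : V → V → Prop) : Prop :=
  ∀ a b b', R a b → R a b' → b = b'

/-- `D` is a (subset) repair of `R`: a maximal consistent subrelation of `R`. -/
def Repair {V : Type*} (R D : V → V → Prop) : Prop :=
  (∀ a b, D a b → R a b) ∧ Consistent D ∧
  ∀ D' : V → V → Prop, Consistent D' → (∀ a b, D a b → D' a b) →
    (∀ a b, D' a b → R a b) → D' = D

/-- A closed walk of length `n` in `D`: a map `ZMod n → V` following `D`-edges. -/
def IsClosedWalk {V : Type*} (D : V → V → Prop) (n : ℕ) (g : ZMod n → V) : Prop :=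
  ∀ i, D (g i) (g (i + 1))

/-- The structure in the language of a single binary relation symbol given by interpreting
the relation symbol as `R`. -/
def relStructure {V : Type*} (R : V → V → Prop) : Language.graph.Structure V where
  RelMap | .adj => fun x => R (x 0) (x 1)

section Cut

variable {V : Type}

/-- Two relations `R` and `S` on a set with positions `pos` and a position-preserving involution
`flip` that agree below position `B` and agree up to `flip` above position `0`, all edges having
length at most `d`. -/
structure IsCutPair (R S : V → V → Prop) (pos : V → ℕ) (flip : V → V) (d B : ℕ) : Prop where
  flip_flip : ∀ x, flip (flip x) = x
  pos_flip : ∀ x, pos (flip x) = pos x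
  left_short : ∀ x y, R x y → pos x ≤ pos y + d ∧ pos y ≤ pos x + d
  right_short : ∀ x y, S x y → pos x ≤ pos y + d ∧ pos y ≤ pos x + d
  low : ∀ x y, pos x < B → pos y < B → (R x y ↔ S x y)
  high : ∀ x y, 0 < pos x → 0 < pos y → (R x y ↔ S (flip x) (flip y))

/-- The map that is the identity below position `t` and `flip` from position `t` on. -/
def cutMap (pos : V → ℕ) (flip : V → V) (t : ℕ) (x : V) : V :=
  if pos x < t then x else flip x

/-- The position of `x` is outside the window of radius `r` around `t`. -/
def Avoids (pos : V → ℕ) (t r : ℕ) (x : V) : Prop :=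
  pos x + r < t ∨ t + r ≤ pos x

variable {R S : V → V → Prop} {pos : V → ℕ} {flip : V → V} {d B : ℕ}

theorem Avoids.mono {t r r' : ℕ} {x : V} (h : Avoids pos t r x) (hr : r' ≤ r) :
    Avoids pos t r' x := by
  unfold Avoids at *; omega

theorem IsCutPair.pos_cutMap (h : IsCutPair R S pos flip d B) (t : ℕ) (x : V) :
    pos (cutMap pos flip t x) = pos x := by
  unfold cutMap; split_ifs <;> simp [h.pos_flip]

theorem IsCutPair.cutMap_cutMap (h : IsCutPair R S pos flip d B) (t : ℕ) (x : V) :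
    cutMap pos flip t (cutMap pos flip t x) = x := by
  by_cases hx : pos x < t <;> simp [cutMap, hx, h.pos_flip, h.flip_flip]

theorem IsCutPair.rel_iff (h : IsCutPair R S pos flip d B) {t r : ℕ} (hr : d < r) (hrt : r ≤ t)
    (htB : t + r ≤ B) {x y : V} (hx : Avoids pos t r x) (hy : Avoids pos t r y) :
    R x y ↔ S (cutMap pos flip t x) (cutMap pos flip t y) := by
  unfold Avoids at hx hy
  by_cases hx' : pos x < t <;> by_cases hy' : pos y < t
  · simpa [cutMap, hx', hy'] using h.low x y (by omega) (by omega)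
  · constructor <;> intro hxy
    · have := h.left_short _ _ hxy; omega
    · have := h.right_short _ _ hxy; simp only [h.pos_cutMap] at this; omega
  · constructor <;> intro hxy
    · have := h.left_short _ _ hxy; omega
    · have := h.right_short _ _ hxy; simp only [h.pos_cutMap] at this; omega
  · simpa [cutMap, hx', hy'] using h.high x y (by omega) (by omega)

theorem cutMap_eq_of_avoids {t t' r : ℕ} {x : V} (hx : Avoids pos t r x) (h₁ : t ≤ t' + r)
    (h₂ : t' ≤ t + r) : cutMap pos flip t' x = cutMap pos flip t x := by
  unfold Avoids at hx
  unfold cutMap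
  split_ifs <;> first | rfl | omega

theorem exists_avoids (pos : V → ℕ) {t r B : ℕ} (hrt : 2 * r ≤ t) (htB : t + 2 * r ≤ B) (x : V) :
    ∃ t', t ≤ t' + r ∧ t' ≤ t + r ∧ r ≤ t' ∧ t' + r ≤ B ∧ Avoids pos t' r x ∧
      ∀ y, Avoids pos t (2 * r) y → Avoids pos t' r y := by
  unfold Avoids
  by_cases pos x < t
  · exact ⟨t + r, by omega, by omega, by omega, by omega, by omega, fun y hy => by omega⟩
  · exact ⟨t - r, by omega, by omega, by omega, by omega, by omega, fun y hy => by omega⟩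

/-- Satisfaction of a formula in `V` with the relation symbol interpreted as `R`. -/
def RelRealize (R : V → V → Prop) {n : ℕ} (ψ : Language.graph.BoundedFormula Empty n)
    (xs : Fin n → V) : Prop :=
  @Language.BoundedFormula.Realize Language.graph V (relStructure R) Empty n ψ default xs

theorem graph_term_eq_var {n : ℕ} (s : Language.graph.Term (Empty ⊕ Fin n)) :
    ∃ i, s = Language.Term.var (Sum.inr i) := by
  cases s with
  | var a =>
    cases a with
    | inl e => exact e.elim
    | inr i => exact ⟨i, rfl⟩
  | func f _ => exact isEmptyElim f

/-- Formulas cannot tell the two relations of a cut pair apart on tuples that avoid a large enough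
window around the cut. -/
theorem exists_radius_realize_iff (d : ℕ) {n : ℕ} (ψ : Language.graph.BoundedFormula Empty n) :
    ∃ r, ∀ (V : Type) (R S : V → V → Prop) (pos : V → ℕ) (flip : V → V) (B : ℕ),
      IsCutPair R S pos flip d B → ∀ t, r ≤ t → t + r ≤ B →
      ∀ xs : Fin n → V, (∀ i, Avoids pos t r (xs i)) →
        (RelRealize R ψ xs ↔ RelRealize S ψ (cutMap pos flip t ∘ xs)) := by
  induction ψ with
  | falsum => exact ⟨0, fun _ _ _ _ _ _ _ _ _ _ _ _ => Iff.rfl⟩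
  | equal s₁ s₂ =>
    obtain ⟨i, rfl⟩ := graph_term_eq_var s₁
    obtain ⟨j, rfl⟩ := graph_term_eq_var s₂
    refine ⟨0, fun V R S pos flip B h t _ _ xs _ => ?_⟩
    exact ((Function.LeftInverse.injective (h.cutMap_cutMap t)).eq_iff
      (a := xs i) (b := xs j)).symm
  | rel ρ ts =>
    cases ρ
    obtain ⟨i, hi⟩ := graph_term_eq_var (ts 0)
    obtain ⟨j, hj⟩ := graph_term_eq_var (ts 1)
    refine ⟨d + 1, fun V R S pos flip B h t hrt htB xs hxs => ?_⟩
    have key : ∀ (Q : V → V → Prop) (ys : _ → V),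
        RelRealize Q (Language.BoundedFormula.rel Language.graphRel.adj ts) ys ↔
          Q (ys i) (ys j) := by
      intro Q ys
      change Q (@Language.Term.realize _ _ (relStructure Q) _ _ (ts 0))
        (@Language.Term.realize _ _ (relStructure Q) _ _ (ts 1)) ↔ _
      rw [hi, hj]
      rfl
    rw [key, key]
    exact h.rel_iff (Nat.lt_succ_self d) hrt htB (hxs i) (hxs j)
  | imp ψ₁ ψ₂ ih₁ ih₂ =>
    obtain ⟨r₁, h₁⟩ := ih₁
    obtain ⟨r₂, h₂⟩ := ih₂
    refine ⟨max r₁ r₂, fun V R S pos flip B h t hrt htB xs hxs => ?_⟩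
    exact imp_congr
      (h₁ V R S pos flip B h t (by omega) (by omega) xs fun i => (hxs i).mono (by omega))
      (h₂ V R S pos flip B h t (by omega) (by omega) xs fun i => (hxs i).mono (by omega))
  | @all n ψ ih =>
    obtain ⟨r, hr⟩ := ih
    refine ⟨2 * r, fun V R S pos flip B h t hrt htB xs hxs => ?_⟩
    have snoc_iff : ∀ t', t ≤ t' + r → t' ≤ t + r → r ≤ t' → t' + r ≤ B →
        (∀ y, Avoids pos t (2 * r) y → Avoids pos t' r y) → ∀ x, Avoids pos t' r x →
        (RelRealize R ψ (Fin.snoc xs x) ↔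
          RelRealize S ψ (Fin.snoc (cutMap pos flip t ∘ xs) (cutMap pos flip t' x))) := by
      intro t' h₁ h₂ h₃ h₄ hav x hx
      have hsnoc : Fin.snoc (cutMap pos flip t ∘ xs) (cutMap pos flip t' x) =
          cutMap pos flip t' ∘ (Fin.snoc xs x : Fin (n + 1) → V) := by
        funext i
        refine Fin.lastCases ?_ (fun i => ?_) i
        · simp
        · simpa using (cutMap_eq_of_avoids (hxs i) (by omega) (by omega)).symm
      rw [hsnoc]
      refine hr V R S pos flip B h t' h₃ h₄ _ fun i => ?_
      refine Fin.lastCases ?_ (fun i => ?_) i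
      · simpa using hx
      · simpa using hav _ (hxs i)
    constructor
    · intro hR y
      obtain ⟨t', h₁, h₂, h₃, h₄, hy, hav⟩ := exists_avoids pos hrt htB y
      have hx : Avoids pos t' r (cutMap pos flip t' y) := by
        simpa only [Avoids, h.pos_cutMap] using hy
      have := (snoc_iff t' h₁ h₂ h₃ h₄ hav _ hx).1 (hR _)
      rwa [h.cutMap_cutMap] at this
    · intro hS x
      obtain ⟨t', h₁, h₂, h₃, h₄, hx, hav⟩ := exists_avoids pos hrt htB x
      exact (snoc_iff t' h₁ h₂ h₃ h₄ hav x hx).2 (hS _)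

end Cut

section Repair

variable {V : Type} {R D : V → V → Prop}

theorem Repair.exists_rel (h : Repair R D) {x y : V} (hxy : R x y) : ∃ z, D x z := by
  by_contra! hx
  have hD' := h.2.2 (fun a b => D a b ∨ a = x ∧ b = y) ?_ (fun a b hab => Or.inl hab) ?_
  · exact hx y (hD' ▸ Or.inr ⟨rfl, rfl⟩)
  · rintro a b b' (hab | ⟨rfl, rfl⟩) (hab' | ⟨ha, rfl⟩)
    · exact h.2.1 a b b' hab hab'
    · exact absurd hab (ha ▸ hx b)
    · exact absurd hab' (hx b')
    · rfl
  · rintro a b (hab | ⟨rfl, rfl⟩)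
    · exact h.1 a b hab
    · exact hxy

/-- If `R x y` holds and `y` is the only `R`-successor of `x`, every repair contains the edge. -/
theorem Repair.rel_of_unique (h : Repair R D) {x y : V} (hxy : R x y)
    (huniq : ∀ z, R x z → z = y) : D x y := by
  obtain ⟨z, hz⟩ := h.exists_rel hxy
  exact huniq z (h.1 _ _ hz) ▸ hz

theorem repair_of_forall_exists (hDR : ∀ a b, D a b → R a b) (hD : Consistent D)
    (hex : ∀ a b, R a b → ∃ c, D a c) : Repair R D := by
  refine ⟨hDR, hD, fun D' hD' hle hD'R => ?_⟩
  funext a b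
  refine propext ⟨fun hab => ?_, hle a b⟩
  obtain ⟨c, hc⟩ := hex a b (hD'R a b hab)
  exact hD' a b c hab (hle a c hc) ▸ hc

end Repair

/-- The edges of a chain of `N` directed cycles of length `d + 1` on the natural numbers:
downward steps `p + 1 → p`, and jumps `i * d + 1 → i * d + 1 + d`. The propositions `a` and `b`
say whether the bottom and the top of the chain have an additional edge to a sink. -/
def ChainRel (d N : ℕ) (a b : Prop) (p q : ℕ) : Prop :=
  (q + 1 = p ∧ p ≤ N * d + 1 ∧ (p = 1 → a)) ∨
    ∃ i, i ≤ N ∧ p = i * d + 1 ∧ q = p + d ∧ (i = N → b)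

/-- Vertices: two chains, and cycles of lengths `k j`. -/
abbrev ChainVertex {m : ℕ} (k : Fin m → ℕ) (L : ℕ) : Type :=
  (Bool × Fin L) ⊕ (Σ j, ZMod (k j))

/-- The disjoint union of the chains with open ends described by `a` and `b`, and of the cycles of
length `k j` for `j ≠ i₀`. -/
def chainsRel {m : ℕ} (k : Fin m → ℕ) (i₀ : Fin m) (d N : ℕ) (a b : Bool → Prop) {L : ℕ} :
    ChainVertex k L → ChainVertex k L → Prop
  | .inl x, .inl y => x.1 = y.1 ∧ ChainRel d N (a x.1) (b x.1) x.2 y.2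
  | .inr x, .inr y => x.1 ≠ i₀ ∧ y = ⟨x.1, x.2 + 1⟩
  | _, _ => False

def chainPos {m : ℕ} (k : Fin m → ℕ) {L : ℕ} : ChainVertex k L → ℕ
  | .inl x => x.2
  | .inr _ => 0

def chainFlip {m : ℕ} (k : Fin m → ℕ) {L : ℕ} : ChainVertex k L → ChainVertex k L
  | .inl x => .inl (!x.1, x.2)
  | .inr x => .inr x

theorem ChainRel.short {d N : ℕ} {a b : Prop} {p q : ℕ} (hd : 1 ≤ d) (h : ChainRel d N a b p q) :
    p ≤ q + d ∧ q ≤ p + d := by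
  obtain h | ⟨i, _, _, h, _⟩ := h <;> omega

theorem chainRel_congr_top {d N : ℕ} {a b b' : Prop} {p q : ℕ} (hp : p < N * d + 1) :
    ChainRel d N a b p q ↔ ChainRel d N a b' p q := by
  have key : ∀ {b b' : Prop}, ChainRel d N a b p q → ChainRel d N a b' p q := by
    rintro b b' (h | ⟨i, hi, rfl, hq, hb⟩)
    · exact Or.inl h
    · exact Or.inr ⟨i, hi, rfl, hq, by rintro rfl; omega⟩
  exact ⟨key, key⟩

theorem chainRel_congr_bot {d N : ℕ} {a a' b : Prop} {p q : ℕ} (hq : 0 < q) :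
    ChainRel d N a b p q ↔ ChainRel d N a' b p q := by
  unfold ChainRel
  constructor <;> rintro (h | h) <;> first | exact Or.inr h | exact Or.inl (by omega)

theorem isCutPair_chainsRel {m : ℕ} (k : Fin m → ℕ) (i₀ : Fin m) {d : ℕ} (hd : 1 ≤ d) (N L : ℕ) :
    IsCutPair (chainsRel k i₀ d N (fun c => c = true) (fun c => c = true) (L := L))
      (chainsRel k i₀ d N (fun c => c = true) (fun c => c = false))
      (chainPos k) (chainFlip k) d (N * d + 1) where
  flip_flip := by rintro (x | x) <;> simp [chainFlip]
  pos_flip := by rintro (x | x) <;> rfl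
  left_short := by
    rintro (x | x) (y | y) h <;> simp only [chainsRel] at h
    · exact h.2.short hd
    · simp [chainPos]
  right_short := by
    rintro (x | x) (y | y) h <;> simp only [chainsRel] at h
    · exact h.2.short hd
    · simp [chainPos]
  low := by
    rintro (x | x) (y | y) hx hy <;> try rfl
    exact and_congr_right fun _ => chainRel_congr_top hx
  high := by
    rintro (⟨c, p⟩ | x) (⟨c', q⟩ | y) hx hy <;> try rfl
    refine and_congr (by cases c <;> cases c' <;> simp) ?_
    refine (chainRel_congr_bot (a' := (!c) = true) hy).trans ?_
    cases c <;> simp [chainPos]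

section ClosedWalks

variable {m : ℕ} {k : Fin m → ℕ} {i₀ : Fin m} {d N L : ℕ} {a b : Bool → Prop}
  {D : ChainVertex k L → ChainVertex k L → Prop}

/-- Every repair contains the added cycles. -/
theorem exists_closedWalk_of_ne (hD : Repair (chainsRel k i₀ d N a b) D) {j : Fin m}
    (hj : j ≠ i₀) : ∃ g : ZMod (k j) → ChainVertex k L, IsClosedWalk D (k j) g := by
  refine ⟨fun z => .inr ⟨j, z⟩, fun z => hD.rel_of_unique ⟨hj, rfl⟩ ?_⟩
  rintro (y | y) h
  · exact h.elim
  · exact congrArg Sum.inr h.2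

/-- A chain with both ends closed contains a cycle of length `d + 1` in every repair. -/
theorem exists_closedWalk_of_closed_chain (hd : 1 ≤ d) (hN : 1 ≤ N) (hL : N * d + 1 < L)
    {c : Bool} (ha : ¬ a c) (hb : ¬ b c) (hD : Repair (chainsRel k i₀ d N a b) D) {n : ℕ}
    (hn : n = d + 1) : ∃ g : ZMod n → ChainVertex k L, IsClosedWalk D n g := by
  subst hn
  let v : ∀ p, p < L → ChainVertex k L := fun p hp => .inl (c, ⟨p, hp⟩)
  have succ_of : ∀ p (hp : p < L) y, chainsRel k i₀ d N a b (v p hp) y →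
      ∃ q, ∃ hq : q < L, y = v q hq ∧ ChainRel d N (a c) (b c) p q := by
    rintro p hp (⟨c', q, hq⟩ | y) h
    · obtain ⟨h₁, h₂⟩ := h
      obtain rfl : c = c' := h₁
      exact ⟨q, hq, rfl, h₂⟩
    · exact h.elim
  let U : ℕ → Prop := fun i => ∃ (h₁ : i * d + 1 < L) (h₂ : i * d + 1 + d < L),
    D (v (i * d + 1) h₁) (v (i * d + 1 + d) h₂)
  have mul_lt : ∀ {i}, i ≤ N → i * d + 1 < L := fun hi =>
    lt_of_le_of_lt (Nat.succ_le_succ (Nat.mul_le_mul_right d hi)) hL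
  have mul_lt' : ∀ {i}, i + 1 ≤ N → i * d + 1 + d < L := fun {i} hi => by
    have := mul_lt hi
    rw [Nat.succ_mul] at this
    omega
  have up_or_down : ∀ i, i ≤ N → 1 ≤ i → U i ∨
      ∃ (h₁ : i * d + 1 < L) (h₂ : i * d < L), D (v (i * d + 1) h₁) (v (i * d) h₂) := by
    intro i hi hi1
    have hpos : 0 < i * d := Nat.mul_pos hi1 hd
    have hlt := mul_lt hi
    obtain ⟨y, hy⟩ := hD.exists_rel (x := v (i * d + 1) hlt) (y := v (i * d) (by omega))
      ⟨rfl, Or.inl ⟨rfl, Nat.succ_le_succ (Nat.mul_le_mul_right d hi), by dsimp only; omega⟩⟩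
    obtain ⟨q, hq, rfl, h | ⟨j, _, _, rfl, _⟩⟩ := succ_of _ _ _ (hD.1 _ _ hy)
    · obtain rfl : q = i * d := by omega
      exact Or.inr ⟨hlt, hq, hy⟩
    · exact Or.inl ⟨hlt, hq, hy⟩
  have not_up_top : ¬ U N := by
    rintro ⟨h₁, h₂, h⟩
    obtain ⟨q, hq, hqe, h⟩ := succ_of _ _ _ (hD.1 _ _ h)
    obtain rfl : N * d + 1 + d = q := by simpa [v] using hqe
    obtain h | ⟨j, _, hj, _, hjb⟩ := h
    · omega
    · exact hb (hjb (Nat.eq_of_mul_eq_mul_right hd (Nat.succ_injective hj)).symm)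
  have up_bot : U 0 := by
    obtain ⟨y, hy⟩ := hD.exists_rel (x := v (0 * d + 1) (mul_lt N.zero_le))
      (y := v (0 * d + 1 + d) (mul_lt' hN))
      ⟨rfl, Or.inr ⟨0, N.zero_le, rfl, rfl, by omega⟩⟩
    obtain ⟨q, hq, rfl, h | ⟨j, _, _, rfl, _⟩⟩ := succ_of _ _ _ (hD.1 _ _ hy)
    · exact absurd (h.2.2 (by simp)) ha
    · exact ⟨_, hq, hy⟩
  obtain ⟨i, hiN, hi, hi'⟩ : ∃ i, i + 1 ≤ N ∧ U i ∧ ¬ U (i + 1) := by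
    by_contra! hcon
    have : ∀ i, i ≤ N → U i := fun i => by
      induction i with
      | zero => exact fun _ => up_bot
      | succ i ih => exact fun hi => hcon i hi (ih (by omega))
    exact not_up_top (this N le_rfl)
  obtain ⟨h₁, h₂, hup⟩ := hi
  obtain ⟨h₃, h₄, hdown⟩ := (up_or_down (i + 1) hiN (by omega)).resolve_left hi'
  have hstep : ∀ s (hs : s < d), D (v (i * d + 1 + (s + 1)) (by omega))
      (v (i * d + 1 + s) (by omega)) := by
    intro s hs
    obtain hs' | hs' := Nat.lt_or_eq_of_le hs
    · refine hD.rel_of_unique ⟨rfl, Or.inl ⟨rfl, ?_, by dsimp only; omega⟩⟩ fun y hy => ?_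
      · have := Nat.mul_le_mul_right d hiN
        rw [Nat.succ_mul] at this
        dsimp only
        omega
      · obtain ⟨q, hq, rfl, h | ⟨j, _, hj, rfl, _⟩⟩ := succ_of _ _ _ hy
        · obtain rfl : q = i * d + 1 + s := by omega
          rfl
        · have h₅ : i * d < j * d := by omega
          have h₆ : j * d < (i + 1) * d := by rw [Nat.succ_mul]; omega
          have h₇ := Nat.lt_of_mul_lt_mul_right h₅
          have h₈ := Nat.lt_of_mul_lt_mul_right h₆
          omega
    · have h₅ : (i + 1) * d + 1 = i * d + 1 + s + 1 := by rw [Nat.succ_mul]; omega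
      have h₆ : (i + 1) * d = i * d + 1 + s := by omega
      simpa only [h₅, h₆, ← Nat.add_assoc] using hdown
  have hval : ∀ z : ZMod (d + 1), z.val < d + 1 := ZMod.val_lt
  refine ⟨fun z => v (i * d + 1 + (d - z.val)) (by omega), fun z => ?_⟩
  have hone : (1 : ZMod (d + 1)).val = 1 := by
    rw [ZMod.val_one_eq_one_mod, Nat.mod_eq_of_lt (by omega)]
  have hadd : (z + 1).val = (z.val + 1) % (d + 1) := by rw [ZMod.val_add, hone]
  obtain hz | hz := Nat.lt_or_eq_of_le (Nat.le_of_lt_succ (hval z))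
  · rw [Nat.mod_eq_of_lt (by omega)] at hadd
    have h₅ : d - z.val = d - (z.val + 1) + 1 := by omega
    simpa only [hadd, h₅] using hstep (d - (z.val + 1)) (by omega)
  · rw [hz, Nat.mod_self] at hadd
    simpa only [hadd, hz, Nat.sub_self, Nat.sub_zero, Nat.add_zero] using hup

/-- If every `D`-edge between chain vertices increases `f`, and `k i₀` is not a multiple of the
other `k j`, then `D` has no closed walk of length `k i₀`. -/
theorem not_isClosedWalk_of_increasing [NeZero (k i₀)] (hdvd : ∀ j, j ≠ i₀ → ¬ k j ∣ k i₀)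
    (hDR : ∀ x y, D x y → chainsRel k i₀ d N a b x y) (f : Bool × Fin L → ℤ)
    (hf : ∀ x y, D (.inl x) (.inl y) → f x < f y) (g : ZMod (k i₀) → ChainVertex k L) :
    ¬ IsClosedWalk D (k i₀) g := by
  intro hg
  obtain ⟨z, hz⟩ := Finite.exists_max fun z => Sum.elim f (fun _ => 0) (g z)
  rcases hgz : g z with x | ⟨j, w⟩
  · have h := hg z
    rw [hgz] at h
    rcases hgz' : g (z + 1) with y | y
    · have := hz (z + 1)
      rw [hgz'] at h
      rw [hgz, hgz'] at this
      exact absurd (hf x y h) (not_lt.2 this)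
    · rw [hgz'] at h
      exact hDR _ _ h
  · have step : ∀ y (w' : ZMod (k j)), g y = .inr ⟨j, w'⟩ →
        j ≠ i₀ ∧ g (y + 1) = .inr ⟨j, w' + 1⟩ := by
      intro y w' hy
      have h := hDR _ _ (hg y)
      rw [hy] at h
      rcases hy' : g (y + 1) with u | u
      · rw [hy'] at h
        exact h.elim
      · rw [hy'] at h
        exact ⟨h.1, congrArg Sum.inr h.2⟩
    have iter : ∀ t : ℕ, g (z + t) = .inr ⟨j, w + t⟩ := by
      intro t
      induction t with
      | zero => simpa using hgz
      | succ t ih => simpa [add_assoc] using (step _ _ ih).2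
    have h := iter (k i₀)
    rw [ZMod.natCast_self, add_zero, hgz] at h
    have h' : ((k i₀ : ℕ) : ZMod (k j)) = 0 := by simpa using h
    exact hdvd j (step z w hgz).1 ((ZMod.natCast_eq_zero_iff _ _).1 h')

end ClosedWalks

/-- The successor of `p` in a chain: always downwards if `c` is `true`, and upwards whenever
possible otherwise. -/
def chainNext (d : ℕ) (c : Bool) (p : ℕ) : ℕ :=
  if c = true ∨ ¬ d ∣ p - 1 then p - 1 else p + d

/-- The repair that descends in the chain `true` and ascends in the chain `false`. -/
def acyclicRepair {m : ℕ} (k : Fin m → ℕ) (i₀ : Fin m) (d N : ℕ) {L : ℕ} :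
    ChainVertex k L → ChainVertex k L → Prop
  | .inl x, .inl y => x.1 = y.1 ∧ 1 ≤ (x.2 : ℕ) ∧ (x.2 : ℕ) ≤ N * d + 1 ∧
      (y.2 : ℕ) = chainNext d x.1 x.2
  | .inr x, .inr y => x.1 ≠ i₀ ∧ y = ⟨x.1, x.2 + 1⟩
  | _, _ => False

theorem repair_acyclicRepair {m : ℕ} (k : Fin m → ℕ) (i₀ : Fin m) {d N L : ℕ} (hd : 1 ≤ d)
    (hL : L = N * d + d + 2) :
    Repair (chainsRel k i₀ d N (fun c => c = true) (fun c => c = false))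
      (acyclicRepair k i₀ d N (L := L)) := by
  refine repair_of_forall_exists ?_ ?_ ?_
  · rintro (⟨c, p⟩ | x) (⟨c', q⟩ | y) h
    · obtain ⟨hc, h₁, h₂, h₃⟩ := h
      refine ⟨hc, ?_⟩
      dsimp only [chainNext] at h₁ h₂ h₃ ⊢
      split_ifs at h₃ with hp
      · refine Or.inl ⟨by omega, h₂, fun h₄ => hp.resolve_right ?_⟩
        simp [h₄]
      · push Not at hp
        obtain ⟨i, hi⟩ := hp.2
        rw [Nat.mul_comm] at hi
        refine Or.inr ⟨i, Nat.le_of_mul_le_mul_right (c := d) (b := N) (by omega) hd, by omega, h₃,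
          fun _ => by simpa using hp.1⟩
    · exact h
    · exact h
    · exact h
  · rintro (⟨c, p⟩ | x) (⟨c', q⟩ | y) (⟨c'', q'⟩ | y') h h'
    all_goals try first | exact h.elim | exact h'.elim
    · obtain ⟨hc, -, -, hq⟩ := h
      obtain ⟨hc', -, -, hq'⟩ := h'
      exact congrArg Sum.inl (Prod.ext (hc.symm.trans hc') (Fin.ext (hq.trans hq'.symm)))
    · exact congrArg Sum.inr (h.2.trans h'.2.symm)
  · rintro (⟨c, p⟩ | x) (⟨c', q⟩ | y) h
    · have hp : 1 ≤ (p : ℕ) ∧ (p : ℕ) ≤ N * d + 1 := by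
        obtain ⟨h₁, h₂, -⟩ | ⟨i, hi, h₁, -, -⟩ := h.2
        · dsimp only at h₁
          exact ⟨by omega, h₂⟩
        · have := Nat.mul_le_mul_right d hi
          dsimp only at h₁
          omega
      have hlt : chainNext d c p < L := by
        have := p.2
        unfold chainNext
        split_ifs <;> omega
      exact ⟨.inl (c, ⟨_, hlt⟩), rfl, hp.1, hp.2, rfl⟩
    · exact h.elim
    · exact h.elim
    · exact ⟨.inr y, h⟩

theorem exists_potential_acyclicRepair {m : ℕ} (k : Fin m → ℕ) (i₀ : Fin m) {d : ℕ} (hd : 1 ≤ d)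
    (N L : ℕ) : ∃ f : Bool × Fin L → ℤ, ∀ x y,
      acyclicRepair k i₀ d N (.inl x) (.inl y) → f x < f y := by
  refine ⟨fun x => if x.1 = true then -((x.2 : ℕ) : ℤ)
    else (((x.2 : ℕ) - 1) / d : ℕ) - (((x.2 : ℕ) - 1) % d : ℕ), ?_⟩
  rintro ⟨c, p, hp⟩ ⟨c', q, hq⟩ ⟨hc, h₁, -, h₂⟩
  obtain rfl : c = c' := hc
  dsimp only [chainNext] at h₁ h₂ ⊢
  cases c
  · by_cases hdvd : d ∣ p - 1
    · obtain rfl : q = p + d := by simpa [hdvd] using h₂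
      have : p + d - 1 = p - 1 + d := by omega
      simp [this, Nat.add_div_right _ hd]
    · obtain rfl : q = p - 1 := by simpa [hdvd] using h₂
      have hmod : 0 < (p - 1) % d := Nat.pos_of_ne_zero fun h => hdvd (Nat.dvd_of_mod_eq_zero h)
      have hdm := Nat.div_add_mod (p - 1) d
      have hlt := Nat.mod_lt (p - 1) hd
      have heq : p - 1 - 1 = (p - 1) % d - 1 + d * ((p - 1) / d) := by omega
      have hdiv : (p - 1 - 1) / d = (p - 1) / d := by
        rw [heq, Nat.add_mul_div_left _ _ hd, Nat.div_eq_of_lt (by omega), Nat.zero_add]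
      have hmod' : (p - 1 - 1) % d = (p - 1) % d - 1 := by
        rw [heq, Nat.add_mul_mod_self_left, Nat.mod_eq_of_lt (by omega)]
      simp only [hdiv, hmod', Bool.false_eq_true, if_false]
      omega
  · obtain rfl : q = p - 1 := by simpa using h₂
    simp only [if_true]
    omega

theorem stmt14 (m : ℕ) (hm : 1 ≤ m) (k : Fin m → ℕ) (hk2 : ∀ i, 2 ≤ k i)
    (hdvd : ∀ i j, i ≠ j → ¬ (k i ∣ k j)) :
    ¬ ∃ φ : Language.graph.Sentence,
        ∀ (V : Type) (_ : Fintype V) (R : V → V → Prop),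
          (@FirstOrder.Language.Sentence.Realize Language.graph V (relStructure R) φ) ↔
          (∀ D : V → V → Prop, Repair R D →
            ∀ i : Fin m, ∃ g : ZMod (k i) → V, IsClosedWalk D (k i) g) := by
  rintro ⟨φ, hφ⟩
  have hne : ∀ j, NeZero (k j) := fun j => ⟨by have := hk2 j; omega⟩
  let i₀ : Fin m := ⟨0, hm⟩
  obtain ⟨d, hd⟩ : ∃ d, k i₀ = d + 1 := ⟨k i₀ - 1, by have := hk2 i₀; omega⟩
  have hd1 : 1 ≤ d := by have := hk2 i₀; omega
  obtain ⟨r, hr⟩ := exists_radius_realize_iff d φ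
  let N := 2 * r + 1
  have hN : N ≤ N * d := Nat.le_mul_of_pos_right N hd1
  let L := N * d + d + 2
  have hiff := hr (ChainVertex k L) _ _ _ _ _ (isCutPair_chainsRel k i₀ hd1 N L) r le_rfl
    (by omega) default (fun i => i.elim0)
  rw [Subsingleton.elim (cutMap _ _ _ ∘ default) default] at hiff
  have hleft := (hφ (ChainVertex k L) inferInstance
    (chainsRel k i₀ d N (fun c => c = true) (fun c => c = true))).2 fun D hD j => by
      by_cases hj : j = i₀
      · subst hj
        exact exists_closedWalk_of_closed_chain hd1 (by omega) (by omega) (c := false)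
          (by simp) (by simp) hD hd
      · exact exists_closedWalk_of_ne hD hj
  have hrep := repair_acyclicRepair k i₀ hd1 (rfl : L = N * d + d + 2)
  obtain ⟨g, hg⟩ := (hφ (ChainVertex k L) inferInstance _).1 (hiff.1 hleft) _ hrep i₀
  obtain ⟨f, hf⟩ := exists_potential_acyclicRepair k i₀ hd1 N L
  exact not_isClosedWalk_of_increasing (fun j hj => hdvd j i₀ hj) hrep.1 f hf g hg
end

section
/- Let W be a nonempty finite type and Q a nonempty relation on W (the canonical database of a Boolean conjunctive query over a single binary relation whose first attribute is a key). Then the following are equivalent: (1) there exists a first-order sentence φ in the language with a single binary relation symbol such that for every finite structure with underlying set V and interpreted relation R, the structure satisfies φ if and only if every repair D of R admits a homomorphism from Q; (2) either there exists n ≥ 1 such that for every finite type V and every consistent relation D on V, a homomorphism from Q to D exists iff D has a walk of length n (Q is equivalent under the key constraint to a path query), or for every finite type V and every consistent relation D on V, a homomorphism from Q to D exists iff D has a self-loop (Q is equivalent under the key constraint to the 1-Cycle query). -/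
open FirstOrder

/-- A walk of length `n` in `D`: a map `f : Fin (n+1) → V` with `D (f i) (f (i+1))`
for all `i < n`. -/
def IsWalk {V : Type*} (D : V → V → Prop) (n : ℕ) (f : Fin (n + 1) → V) : Prop :=
  ∀ i : Fin n, D (f i.castSucc) (f i.succ)

namespace KeyRepair

/-- There is a homomorphism from `Q` to `D`. -/
def HasHom {W V : Type} (Q : W → W → Prop) (D : V → V → Prop) : Prop :=
  ∃ h : W → V, ∀ a b, Q a b → D (h a) (h b)

/-- The sentence `φ` holds in the structure given by `R`. -/
def Models {V : Type} (R : V → V → Prop) (φ : Language.graph.Sentence) : Prop :=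
  @FirstOrder.Language.Sentence.Realize Language.graph V (relStructure R) φ

section Repairs

variable {V : Type} {R D : V → V → Prop}

theorem Repair.exists_edge (h : Repair R D) {a b : V} (hab : R a b) : ∃ c, D a c := by
  by_contra! hc
  have key := h.2.2 (fun x y => D x y ∨ (x = a ∧ y = b)) ?_ (fun x y hxy => Or.inl hxy) ?_
  · have : D a b := by
      rw [← key]
      exact Or.inr ⟨rfl, rfl⟩
    exact hc b this
  · rintro x y y' (h1 | ⟨rfl, rfl⟩) (h2 | ⟨h2, rfl⟩)
    · exact h.2.1 _ _ _ h1 h2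
    · exact absurd (h2 ▸ h1) (hc _)
    · exact absurd h2 (hc _)
    · rfl
  · rintro x y (h1 | ⟨rfl, rfl⟩)
    · exact h.1 _ _ h1
    · exact hab

theorem repair_of_total (hsub : ∀ a b, D a b → R a b) (hc : Consistent D)
    (htot : ∀ a b, R a b → ∃ c, D a c) : Repair R D := by
  refine ⟨hsub, hc, fun D' hD' hle hle' => ?_⟩
  funext a b
  refine propext ⟨fun hab => ?_, hle a b⟩
  obtain ⟨c, hac⟩ := htot a b (hle' a b hab)
  rwa [hD' a b c hab (hle a c hac)]

/-- Every repair of `R` has a walk of length `k` starting at the given vertex. -/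
def Forced (R : V → V → Prop) : ℕ → V → Prop
  | 0, _ => True
  | k + 1, a => (∃ b, R a b) ∧ ∀ b, R a b → Forced R k b

theorem Forced.exists_walk (hD : Repair R D) :
    ∀ {n : ℕ} {a : V}, Forced R n a → ∃ f : Fin (n + 1) → V, f 0 = a ∧ IsWalk D n f
  | 0, a, _ => ⟨fun _ => a, rfl, fun i => i.elim0⟩
  | n + 1, a, ⟨⟨_, hb⟩, hall⟩ => by
    obtain ⟨c, hc⟩ := Repair.exists_edge hD hb
    obtain ⟨f, hf0, hf⟩ := (hall c (hD.1 _ _ hc)).exists_walk hD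
    refine ⟨Fin.cons a f, rfl, fun i => ?_⟩
    refine Fin.cases ?_ (fun j => ?_) i
    · simpa [hf0] using hc
    · simpa [← Fin.succ_castSucc] using hf j

theorem walk_in_repairs_iff (n : ℕ) :
    (∀ D : V → V → Prop, Repair R D → ∃ f : Fin (n + 1) → V, IsWalk D n f) ↔
      ∃ a, Forced R n a := by
  classical
  constructor
  · intro h
    by_contra! hn
    have hex : ∀ a, ∃ k, ¬ Forced R k a := fun a => ⟨n, hn a⟩
    let r : V → ℕ := fun a => Nat.find (hex a)
    have hr0 : ∀ a, 0 < r a := fun a => (Nat.find_pos (hex a)).2 (by simp [Forced])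
    have hstep : ∀ a, ∃ c, ∀ b, R a b → R a c ∧ r c < r a := by
      intro a
      by_cases hb : ∃ b, R a b
      · obtain ⟨k, hk⟩ : ∃ k, r a = k + 1 := ⟨r a - 1, by have := hr0 a; omega⟩
        have hspec : ¬ Forced R (r a) a := Nat.find_spec (hex a)
        rw [hk, Forced, not_and] at hspec
        have := hspec hb
        push Not at this
        obtain ⟨c, hac, hc⟩ := this
        have hle : r c ≤ k := Nat.find_min' (hex c) hc
        exact ⟨c, fun _ _ => ⟨hac, by omega⟩⟩
      · exact ⟨a, fun b hb' => absurd ⟨b, hb'⟩ hb⟩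
    choose next hnext using hstep
    obtain ⟨f, hf⟩ := h (fun a b => R a b ∧ b = next a)
      (repair_of_total (fun _ _ h => h.1) (fun _ _ _ h1 h2 => h1.2.trans h2.2.symm)
        fun a b hab => ⟨next a, (hnext a b hab).1, rfl⟩)
    have hdec : ∀ i : Fin (n + 1), r (f i) + i ≤ r (f 0) := by
      intro i
      induction i using Fin.induction with
      | zero => simp
      | succ i ih =>
        obtain ⟨h1, h2⟩ := hf i
        have := (hnext _ _ h1).2
        rw [← h2] at this
        simp only [Fin.val_castSucc, Fin.val_succ] at ih ⊢
        omega
    have h1 := hdec (Fin.last n)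
    have h2 : r (f 0) ≤ n := Nat.find_min' (hex _) (hn _)
    have h3 := hr0 (f (Fin.last n))
    simp only [Fin.val_last] at h1
    omega
  · rintro ⟨a, ha⟩ D hD
    obtain ⟨f, -, hf⟩ := ha.exists_walk hD
    exact ⟨f, hf⟩

theorem loop_in_repairs_iff :
    (∀ D : V → V → Prop, Repair R D → ∃ a, D a a) ↔ ∃ a, R a a ∧ ∀ b, R a b → b = a := by
  constructor
  · intro h
    by_contra! hn
    have hstep : ∀ a, ∃ c, ∀ b, R a b → R a c ∧ c ≠ a := by
      intro a
      by_cases hb : ∃ b, R a b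
      · by_cases ha : R a a
        · obtain ⟨c, hc⟩ := hn a ha
          exact ⟨c, fun _ _ => hc⟩
        · obtain ⟨b, hb⟩ := hb
          exact ⟨b, fun _ _ => ⟨hb, fun h => ha (h ▸ hb)⟩⟩
      · exact ⟨a, fun b hb' => absurd ⟨b, hb'⟩ hb⟩
    choose next hnext using hstep
    obtain ⟨a, ha1, ha2⟩ := h (fun a b => R a b ∧ b = next a)
      (repair_of_total (fun _ _ h => h.1) (fun _ _ _ h1 h2 => h1.2.trans h2.2.symm)
        fun a b hab => ⟨next a, (hnext a b hab).1, rfl⟩)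
    exact (hnext a a ha1).2 ha2.symm
  · rintro ⟨a, ha, hall⟩ D hD
    obtain ⟨c, hc⟩ := Repair.exists_edge hD ha
    have := hall c (hD.1 _ _ hc)
    exact ⟨a, this ▸ hc⟩

end Repairs

section Sentences

open FirstOrder.Language

/-- The formula expressing that the last variable satisfies `Forced R k`. -/
def forcedFormula : ℕ → ∀ m : ℕ, Language.graph.BoundedFormula Empty (m + 1)
  | 0, _ => ⊤
  | k + 1, m =>
    let edge : Language.graph.BoundedFormula Empty (m + 2) :=
      Relations.boundedFormula₂ Language.adj (&(Fin.last m).castSucc) (&(Fin.last (m + 1)))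
    edge.ex ⊓ (edge.imp (forcedFormula k (m + 1))).all

theorem realize_forcedFormula {V : Type} (R : V → V → Prop) (v : Empty → V) :
    ∀ (k m : ℕ) (xs : Fin (m + 1) → V),
      @BoundedFormula.Realize _ V (relStructure R) _ _ (forcedFormula k m) v xs ↔
        Forced R k (xs (Fin.last m))
  | 0, m, xs => by
    let _ := relStructure R
    simp [forcedFormula, Forced]
  | k + 1, m, xs => by
    let _ := relStructure R
    have hrel : ∀ x y : V, Structure.RelMap Language.adj ![x, y] ↔ R x y := fun _ _ => Iff.rfl
    simp [forcedFormula, Forced, BoundedFormula.realize_rel₂, hrel,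
      realize_forcedFormula R v k (m + 1)]

/-- The sentence expressing that some vertex satisfies `Forced R n`. -/
def forcedSentence (n : ℕ) : Language.graph.Sentence :=
  (forcedFormula n 0).ex

theorem models_forcedSentence {V : Type} (R : V → V → Prop) (n : ℕ) :
    Models R (forcedSentence n) ↔ ∃ a, Forced R n a := by
  let _ := relStructure R
  simp only [Models, Sentence.Realize, Formula.Realize, forcedSentence,
    BoundedFormula.realize_ex, realize_forcedFormula]
  simp [Fin.snoc]

/-- The sentence expressing that some vertex has itself as its only out-neighbour. -/
def loopSentence : Language.graph.Sentence :=
  BoundedFormula.ex <|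
    Relations.boundedFormula₂ (n := 1) Language.adj (&0) (&0) ⊓
      (BoundedFormula.imp (Relations.boundedFormula₂ (n := 2) Language.adj (&0) (&1))
        (BoundedFormula.equal (&1) (&0))).all

theorem models_loopSentence {V : Type} (R : V → V → Prop) :
    Models R loopSentence ↔ ∃ a, R a a ∧ ∀ b, R a b → b = a := by
  let _ := relStructure R
  have hrel : ∀ x y : V, Structure.RelMap Language.adj ![x, y] ↔ R x y := fun _ _ => Iff.rfl
  simp [Models, Sentence.Realize, Formula.Realize, loopSentence, BoundedFormula.Realize,
    BoundedFormula.realize_rel₂, hrel, Fin.snoc]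

end Sentences

section Ultraproducts

open FirstOrder.Language Filter

/-- The type `V` regarded as the structure interpreting the relation symbol as `R`. -/
def Model {V : Type} (_ : V → V → Prop) : Type := V

instance {V : Type} (R : V → V → Prop) : Language.graph.Structure (Model R) :=
  relStructure R

/-- A first-order sentence does not distinguish two sequences of relations which agree far away
from a region and which, on ever larger neighbourhoods of the region, agree up to an involution
preserving the distance `d` to it. -/
theorem exists_models_of_local_involution {V : ℕ → Type} [∀ n, Nonempty (V n)]
    {R S : ∀ n, V n → V n → Prop} {e : ∀ n, V n → V n} {d : ∀ n, V n → ℕ} {c : ℕ}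
    (he : ∀ n, Function.Involutive (e n)) (hde : ∀ n a, d n (e n a) = d n a)
    (hR : ∀ n a b, R n a b → d n a ≤ d n b + c ∧ d n b ≤ d n a + c)
    (hS : ∀ n a b, S n a b → d n a ≤ d n b + c ∧ d n b ≤ d n a + c)
    (hfar : ∀ n a b, 0 < d n a → 0 < d n b → (S n a b ↔ R n a b))
    (hnear : ∀ n a b, d n a < n → d n b < n → (S n (e n a) (e n b) ↔ R n a b))
    {φ : Language.graph.Sentence} (h : ∀ n, Models (R n) φ) : ∃ n, Models (S n) φ := by
  classical
  let u : Ultrafilter ℕ := hyperfilter ℕ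
  have hu : ∀ m : ℕ, ∀ᶠ n in (u : Filter ℕ), m < n := fun m =>
    Nat.hyperfilter_le_atTop (eventually_gt_atTop m)
  let near : (∀ n, V n) → Prop := fun g => ∃ m, ∀ᶠ n in (u : Filter ℕ), d n (g n) ≤ m
  let F : (∀ n, V n) → ∀ n, V n := fun g => if near g then fun n => e n (g n) else g
  have hFnear : ∀ g, near g → F g = fun n => e n (g n) := fun g hg => if_pos hg
  have hFfar : ∀ g, ¬ near g → F g = g := fun g hg => if_neg hg
  have hnear_e : ∀ g, near (fun n => e n (g n)) ↔ near g := fun g => by simp only [near, hde]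
  have hFF : ∀ g, F (F g) = g := by
    intro g
    by_cases hg : near g
    · rw [hFnear g hg, hFnear _ ((hnear_e g).2 hg)]
      funext n
      exact he n _
    · rw [hFfar g hg, hFfar g hg]
  have hcongr : ∀ g g' : ∀ n, V n, (∀ᶠ n in (u : Filter ℕ), g n = g' n) →
      ∀ᶠ n in (u : Filter ℕ), F g n = F g' n := by
    intro g g' hgg
    have hiff : near g ↔ near g' :=
      exists_congr fun m => eventually_congr (hgg.mono fun n hn => by rw [hn])
    by_cases hg : near g
    · rw [hFnear g hg, hFnear g' (hiff.1 hg)]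
      exact hgg.mono fun n hn => congrArg (e n) hn
    · rwa [hFfar g hg, hFfar g' (fun h => hg (hiff.2 h))]
  have hnear_of : ∀ g g' : ∀ n, V n, near g →
      (∀ᶠ n in (u : Filter ℕ), d n (g' n) ≤ d n (g n) + c) → near g' := by
    rintro g g' ⟨m, hm⟩ hle
    exact ⟨m + c, (hm.and hle).mono fun n hn => by omega⟩
  have hpos : ∀ g, ¬ near g → ∀ᶠ n in (u : Filter ℕ), 0 < d n (g n) := by
    intro g hg
    have : ¬ ∀ᶠ n in (u : Filter ℕ), d n (g n) ≤ 0 := fun h => hg ⟨0, h⟩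
    rw [← Ultrafilter.eventually_not] at this
    exact this.mono fun n hn => by omega
  have hrel : ∀ g g' : ∀ n, V n, (∀ᶠ n in (u : Filter ℕ), S n (F g n) (F g' n)) ↔
      ∀ᶠ n in (u : Filter ℕ), R n (g n) (g' n) := by
    intro g g'
    by_cases hg : near g <;> by_cases hg' : near g'
    · rw [hFnear g hg, hFnear g' hg']
      obtain ⟨m, hm⟩ := hg
      obtain ⟨m', hm'⟩ := hg'
      refine eventually_congr ?_
      filter_upwards [hm, hm', hu m, hu m'] with n h1 h2 h3 h4
      exact hnear n _ _ (by omega) (by omega)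
    · rw [hFnear g hg, hFfar g' hg']
      refine iff_of_false (fun h => hg' (hnear_of g g' hg (h.mono fun n hn => ?_)))
        (fun h => hg' (hnear_of g g' hg (h.mono fun n hn => (hR n _ _ hn).2)))
      have := (hS n _ _ hn).2
      rwa [hde] at this
    · rw [hFfar g hg, hFnear g' hg']
      refine iff_of_false (fun h => hg (hnear_of g' g hg' (h.mono fun n hn => ?_)))
        (fun h => hg (hnear_of g' g hg' (h.mono fun n hn => (hR n _ _ hn).1)))
      have := (hS n _ _ hn).1
      rwa [hde] at this
    · rw [hFfar g hg, hFfar g' hg']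
      refine eventually_congr ?_
      filter_upwards [hpos g hg, hpos g' hg'] with n h1 h2
      exact hfar n _ _ h1 h2
  have : ∀ n, Nonempty (Model (R n)) := fun n => inferInstanceAs (Nonempty (V n))
  have : ∀ n, Nonempty (Model (S n)) := fun n => inferInstanceAs (Nonempty (V n))
  let A := (u : Filter ℕ).Product fun n => Model (R n)
  let B := (u : Filter ℕ).Product fun n => Model (S n)
  let f : A → B := Quotient.map F hcongr
  let f' : B → A := Quotient.map F hcongr
  let E : A ≃[Language.graph] B :=
    { toFun := f
      invFun := f'
      left_inv := fun x => Quotient.inductionOn x fun g => congrArg (Quotient.mk _) (hFF g)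
      right_inv := fun x => Quotient.inductionOn x fun g => congrArg (Quotient.mk _) (hFF g)
      map_fun' := fun g => isEmptyElim g
      map_rel' := by
        rintro _ ⟨⟩ x
        choose g hg using fun i => Quotient.exists_rep (x i)
        obtain rfl : (fun i => Quotient.mk _ (g i)) = x := funext hg
        have hx := relMap_quotient_mk' _
          (ps := Ultraproduct.setoidPrestructure (fun n => Model (R n)) u) Language.adj g
        have hy := relMap_quotient_mk' _
          (ps := Ultraproduct.setoidPrestructure (fun n => Model (S n)) u) Language.adj
          fun i => F (g i)
        refine hy.trans (Iff.trans ?_ hx.symm)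
        exact hrel (g 0) (g 1) }
  have hA : A ⊨ φ := (Ultraproduct.sentence_realize φ).2 (Eventually.of_forall h)
  have hB : B ⊨ φ := (StrongHomClass.realize_sentence E φ).1 hA
  exact ((Ultraproduct.sentence_realize φ).1 hB).exists

end Ultraproducts

section Ladder

/-- Two disjoint chains, indexed by `Bool`, on the vertices `0, …, L`: every vertex has an edge to
its predecessor, and every multiple `t` of `p` has an edge to `t + p`. The edge from `0` is removed
on the chain `true`, and the edge from `L` is removed on the chain `β`. -/
def Ladder (p L : ℕ) (β : Bool) (u v : Bool × Fin (L + 1)) : Prop :=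
  u.1 = v.1 ∧ (((v.2 : ℕ) + 1 = u.2 ∧ ¬ ((u.2 : ℕ) = L ∧ u.1 = β)) ∨
    (p ∣ u.2 ∧ (v.2 : ℕ) = u.2 + p ∧ ¬ ((u.2 : ℕ) = 0 ∧ u.1 = true)))

theorem exists_models_ladder {U : Type} (E : U → U → Prop) {p : ℕ} (hp : 1 ≤ p)
    {φ : Language.graph.Sentence}
    (h : ∀ n, Models (Sum.LiftRel E (Ladder p (p * (n + 1)) true)) φ) :
    ∃ n, Models (Sum.LiftRel E (Ladder p (p * (n + 1)) false)) φ := by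
  have hlip : ∀ (β : Bool) (n : ℕ) (a b : U ⊕ Bool × Fin (p * (n + 1) + 1)),
      Sum.LiftRel E (Ladder p (p * (n + 1)) β) a b →
      Sum.elim (fun _ => 0) (fun u : Bool × Fin (p * (n + 1) + 1) => p * (n + 1) - u.2) a ≤
        Sum.elim (fun _ => 0) (fun u : Bool × Fin (p * (n + 1) + 1) => p * (n + 1) - u.2) b + p ∧
      Sum.elim (fun _ => 0) (fun u : Bool × Fin (p * (n + 1) + 1) => p * (n + 1) - u.2) b ≤
        Sum.elim (fun _ => 0) (fun u : Bool × Fin (p * (n + 1) + 1) => p * (n + 1) - u.2) a + p := by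
    rintro β n _ _ (h | ⟨-, h⟩)
    · simp
    · simp only [Sum.elim_inr]
      generalize p * (n + 1) = L at *
      omega
  refine exists_models_of_local_involution
    (R := fun n => Sum.LiftRel E (Ladder p (p * (n + 1)) true))
    (S := fun n => Sum.LiftRel E (Ladder p (p * (n + 1)) false))
    (e := fun n => Sum.map id fun u => (!u.1, u.2))
    (d := fun n => Sum.elim (fun _ => 0) fun u => p * (n + 1) - u.2) (c := p)
    (fun n => ?_) (fun n => ?_) (hlip true) (hlip false) (fun n => ?_) (fun n => ?_) h
  · rintro (a | a) <;> simp
  · rintro (a | a) <;> simp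
  · rintro (a | a) (b | b) ha hb <;> simp only [Sum.elim_inl, Sum.elim_inr, lt_irrefl] at ha hb
    simp only [Sum.liftRel_inr_inr, Ladder]
    have : (a.2 : ℕ) ≠ p * (n + 1) := by omega
    simp only [this, false_and]
  · rintro (a | ⟨s, a⟩) (b | ⟨s', b⟩) ha hb
    · simp
    · simp
    · simp
    · have hL : n < p * (n + 1) := lt_of_lt_of_le (Nat.lt_succ_self n) (Nat.le_mul_of_pos_left _ hp)
      simp only [Sum.elim_inr] at ha hb
      have h0 : (a : ℕ) ≠ 0 := by omega
      simp [Ladder, h0]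

theorem ladder_closedWalk {p L m : ℕ} (hp : 1 ≤ p) (hm : 1 ≤ m) (hL : L = p * m)
    {D : Bool × Fin (L + 1) → Bool × Fin (L + 1) → Prop}
    (hsub : ∀ u v, D u v → Ladder p L true u v)
    (htot : ∀ u v, Ladder p L true u v → ∃ w, D u w) :
    ∃ c : ℕ → Bool × Fin (L + 1), c (p + 1) = c 0 ∧ ∀ i < p + 1, D (c i) (c (i + 1)) := by
  classical
  let g : ℕ → Bool × Fin (L + 1) := fun t => (false, ⟨min t L, by omega⟩)
  have hg : ∀ t ≤ L, ∀ v : Bool × Fin (L + 1), false = v.1 → (v.2 : ℕ) = t → v = g t := by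
    rintro t ht ⟨s, v⟩ rfl hv
    refine Prod.ext rfl (Fin.ext ?_)
    simp only at hv
    simp [hv, g, ht]
  have hcases : ∀ t v, t ≤ L → D (g t) v →
      (v = g (t - 1) ∧ 1 ≤ t) ∨ (p ∣ t ∧ v = g (t + p) ∧ t + p ≤ L) := by
    intro t v ht htv
    have hv := v.2.isLt
    obtain ⟨h1, ⟨h2, -⟩ | ⟨h2, h3, -⟩⟩ := hsub _ _ htv
    · simp only [g, min_eq_left ht] at h1 h2
      exact Or.inl ⟨hg _ (by omega) _ h1 (by omega), by omega⟩
    · simp only [g, min_eq_left ht] at h1 h2 h3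
      exact Or.inr ⟨h2, hg _ (by omega) _ h1 h3, by omega⟩
  have hout : ∀ t, 1 ≤ t → t ≤ L → ∃ v, D (g t) v := by
    intro t h1 ht
    refine htot (g t) (g (t - 1)) ⟨rfl, Or.inl ⟨?_, by simp [g]⟩⟩
    simp only [g, min_eq_left ht]
    omega
  have hpL : p ≤ L := hL ▸ Nat.le_mul_of_pos_right p hm
  have h0 : D (g (p * 0)) (g (p * 1)) := by
    obtain ⟨v, hv⟩ := htot (g 0) (g p) ⟨rfl, Or.inr (by simp [g, hpL])⟩
    obtain ⟨-, h⟩ | ⟨-, rfl, -⟩ := hcases 0 v (Nat.zero_le _) hv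
    · omega
    · simpa using hv
  obtain ⟨i, him, hi, hi'⟩ : ∃ i, i < m ∧ D (g (p * i)) (g (p * (i + 1))) ∧
      ¬ (i + 1 < m ∧ D (g (p * (i + 1))) (g (p * (i + 1 + 1)))) := by
    by_contra! hcon
    have hall : ∀ i, i < m ∧ D (g (p * i)) (g (p * (i + 1))) := by
      intro i
      induction i with
      | zero => exact ⟨hm, h0⟩
      | succ i ih => exact hcon i ih.1 ih.2
    exact lt_irrefl _ (hall m).1
  have htop : p * (i + 1) ≤ L := hL ▸ Nat.mul_le_mul_left p him
  have hdown : ∀ j < p, D (g (p * (i + 1) - j)) (g (p * (i + 1) - (j + 1))) := by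
    intro j hj
    have hpi : p ≤ p * (i + 1) := Nat.le_mul_of_pos_right p (Nat.succ_pos i)
    obtain ⟨v, hv⟩ := hout (p * (i + 1) - j) (by omega) (by omega)
    obtain ⟨rfl, -⟩ | ⟨h1, rfl, h2⟩ := hcases _ v (by omega) hv
    · exact hv
    · exfalso
      have hj0 : j = 0 := by
        have : p ∣ j := (Nat.dvd_sub_iff_right (by omega) (Dvd.intro _ rfl)).1 h1
        exact Nat.eq_zero_of_dvd_of_lt this hj
      subst hj0
      rw [Nat.sub_zero] at h2 hv
      refine hi' ⟨?_, by simpa [Nat.mul_succ] using hv⟩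
      have : p * (i + 1) < p * m := by omega
      exact Nat.lt_of_mul_lt_mul_left this
  refine ⟨fun j => if j = 0 then g (p * i) else g (p * (i + 1) - (j - 1)), ?_, ?_⟩
  · simp [Nat.mul_succ]
  · intro j hj
    rcases j with _ | j
    · simpa using hi
    · simpa using hdown j (by omega)

/-- The choice of edges in the ladder that goes down wherever possible on the chain `true`, and up
wherever possible on the chain `false`. -/
def LadderRepair (p L : ℕ) (u v : Bool × Fin (L + 1)) : Prop :=
  Ladder p L false u v ∧
    if u.1 = false ∧ p ∣ (u.2 : ℕ) then (v.2 : ℕ) = u.2 + p else (v.2 : ℕ) + 1 = u.2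

/-- A quantity increasing along the edges of `LadderRepair`. -/
def potential (p : ℕ) {L : ℕ} (u : Bool × Fin (L + 1)) : ℤ :=
  if u.1 = false ∧ p ∣ (u.2 : ℕ) then u.2 else -u.2


theorem LadderRepair.potential_lt {p L : ℕ} (hp : 1 ≤ p) {u v : Bool × Fin (L + 1)}
    (h : LadderRepair p L u v) : potential p u < potential p v := by
  obtain ⟨⟨h1, -⟩, h2⟩ := h
  unfold potential
  by_cases hu : u.1 = false ∧ p ∣ (u.2 : ℕ)
  · rw [if_pos hu] at h2 ⊢
    rw [if_pos ⟨h1 ▸ hu.1, h2 ▸ (Nat.dvd_add_self_right.2 hu.2)⟩]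
    omega
  · rw [if_neg hu] at h2 ⊢
    split_ifs <;> omega

theorem LadderRepair.consistent (p L : ℕ) : Consistent (LadderRepair p L) := by
  rintro u v w ⟨⟨h1, -⟩, h2⟩ ⟨⟨h3, -⟩, h4⟩
  refine Prod.ext (h1.symm.trans h3) (Fin.ext ?_)
  split_ifs at h2 h4 <;> omega

theorem LadderRepair.total {p L m : ℕ} (hL : L = p * m) {u v : Bool × Fin (L + 1)}
    (h : Ladder p L false u v) : ∃ w, LadderRepair p L u w := by
  obtain ⟨s, t, ht⟩ := u
  obtain ⟨s', t', ht'⟩ := v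
  obtain ⟨h1, h2⟩ := h
  simp only at h1 h2
  by_cases hc : s = false ∧ p ∣ t
  · have htp : t + p ≤ L := by
      obtain ⟨h, h'⟩ | ⟨-, h, -⟩ := h2
      · have hlt : t < p * m := by
          by_contra
          exact h' ⟨by omega, hc.1⟩
        obtain ⟨q, rfl⟩ := hc.2
        have := Nat.lt_of_mul_lt_mul_left hlt
        calc p * q + p = p * (q + 1) := rfl
          _ ≤ p * m := Nat.mul_le_mul_left p this
          _ = L := hL.symm
      · omega
    refine ⟨(s, ⟨t + p, by omega⟩), ⟨rfl, Or.inr ⟨hc.2, rfl, ?_⟩⟩, ?_⟩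
    · simp [hc.1]
    · simp [hc]
  · have ht1 : 1 ≤ t := by
      obtain ⟨h, -⟩ | ⟨hd, -, h⟩ := h2
      · omega
      · by_contra
        refine h ⟨by omega, ?_⟩
        rcases s with _ | _
        · exact absurd ⟨rfl, hd⟩ hc
        · rfl
    refine ⟨(s, ⟨t - 1, by omega⟩), ⟨rfl, Or.inl ⟨by simp only; omega, ?_⟩⟩, ?_⟩
    · rintro ⟨h, h'⟩
      refine hc ⟨h', ?_⟩
      simp only at h
      exact ⟨m, h.trans hL⟩
    · simp only [if_neg hc]
      omega

end Ladder

section Iterates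

variable {W : Type} {Q : W → W → Prop} {f : W → W}

/-- The forward orbit of `a` under `f` is an infinite walk in `Q`. -/
def InfiniteWalk (Q : W → W → Prop) (f : W → W) (a : W) : Prop :=
  ∀ i, Q (f^[i] a) (f^[i + 1] a)

theorem InfiniteWalk.apply_iff {a b : W} (hf : ∀ a b, Q a b → f a = b) (hab : Q a b) :
    InfiniteWalk Q f b ↔ InfiniteWalk Q f a := by
  obtain rfl := hf a b hab
  refine ⟨fun h i => ?_, fun h i => h (i + 1)⟩
  rcases i with _ | i
  · exact hab
  · exact h i

theorem InfiniteWalk.iterate {a : W} (h : InfiniteWalk Q f a) (n : ℕ) :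
    InfiniteWalk Q f (f^[n] a) := fun i => by
  rw [← Function.iterate_add_apply, ← Function.iterate_add_apply]
  simpa [add_assoc, add_comm, add_left_comm] using h (i + n)

/-- If all cycles of `f` reached from `K` have length a multiple of `k`, then there is a grading of `K`
by `ZMod k` increasing by `1` along `f`. -/
theorem exists_zmod_level {k : ℕ} {K : W → Prop}
    (hK : ∀ a, K a → ∀ u v, f^[u] a = f^[v] a → (u : ZMod k) = v) :
    ∃ l : W → ZMod k, ∀ a, K a → l (f a) = l a + 1 := by
  let s : Setoid W :=
    { r := fun a b => ∃ i j, f^[i] a = f^[j] b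
      iseqv := by
        refine ⟨fun a => ⟨0, 0, rfl⟩, fun ⟨i, j, h⟩ => ⟨j, i, h.symm⟩, ?_⟩
        rintro a b c ⟨i, j, h⟩ ⟨l, m, h'⟩
        refine ⟨l + i, j + m, ?_⟩
        rw [Function.iterate_add_apply, h, ← Function.iterate_add_apply, add_comm l j,
          Function.iterate_add_apply, h', ← Function.iterate_add_apply] }
  have hrep : ∀ a, ∃ i j, f^[i] a = f^[j] (Quotient.mk s a).out := fun a =>
    Setoid.symm (Quotient.mk_out a)
  choose i j hij using hrep
  refine ⟨fun a => j a - i a, fun a ha => ?_⟩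
  have hr : (Quotient.mk s (f a)).out = (Quotient.mk s a).out :=
    congrArg Quotient.out (Quotient.sound ⟨0, 1, rfl⟩)
  have h1 := hij a
  have h2 := hij (f a)
  rw [hr] at h2
  generalize (Quotient.mk s a).out = r at h1 h2
  have hcomm : ∀ m n x, f^[m] (f^[n] x) = f^[n] (f^[m] x) := fun m n x =>
    (Function.Commute.iterate_iterate_self f m n).eq x
  have key : f^[j (f a) + i a + i a] a = f^[j a + i (f a) + 1 + i a] a := by
    have e1 : f^[j (f a) + i a + i a] a = f^[i a] (f^[j (f a)] (f^[j a] r)) := by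
      rw [← h1]
      simp only [← Function.iterate_add_apply]
      exact congrArg (fun n => f^[n] a) (by omega)
    have e2 : f^[j a + i (f a) + 1 + i a] a = f^[i a] (f^[j a] (f^[j (f a)] r)) := by
      rw [← h2, ← Function.iterate_succ_apply, ← Function.iterate_add_apply,
        ← Function.iterate_add_apply]
      congr 1
      omega
    rw [e1, e2, hcomm (j a)]
  have := hK a ha _ _ key
  push_cast at this
  linear_combination this

end Iterates

section Hardness

variable {W : Type} {Q : W → W → Prop} {f : W → W}

theorem not_rewritable (hf : ∀ a b, Q a b → f a = b) {k : ℕ} (hk : 2 ≤ k)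
    {x : W} (hx : InfiniteWalk Q f x) (hxk : f^[k] x = x)
    (hmin : ∀ j y, 1 ≤ j → InfiniteWalk Q f y → f^[j] y = y → k ≤ j) [Finite W]
    (φ : Language.graph.Sentence) :
    ¬ ∀ (V : Type) (_ : Fintype V) (R : V → V → Prop),
      Models R φ ↔ ∀ D : V → V → Prop, Repair R D → HasHom Q D := by
  classical
  intro hφ
  obtain ⟨p, rfl⟩ : ∃ p, k = p + 1 := ⟨k - 1, by omega⟩
  have hp : 1 ≤ p := by omega
  let K : W → Prop := fun a => InfiniteWalk Q f a ∧ ∃ i, f^[p + 1] (f^[i] a) = f^[i] a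
  have hKQ : ∀ a b, Q a b → (K b ↔ K a) := by
    intro a b hab
    refine and_congr (InfiniteWalk.apply_iff hf hab) ?_
    obtain rfl := hf a b hab
    constructor
    · rintro ⟨i, hi⟩
      exact ⟨i + 1, hi⟩
    · rintro ⟨i, hi⟩
      refine ⟨i, ?_⟩
      have := congrArg f hi
      rwa [← Function.iterate_succ_apply' f, ← Function.iterate_succ_apply' f,
        Function.iterate_succ_apply, Function.iterate_succ_apply,
        ← Function.iterate_succ_apply' f, Function.iterate_succ_apply] at this
  have hKper : ∀ a, K a → ∀ u v, f^[u] a = f^[v] a → (u : ZMod (p + 1)) = v := by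
    rintro a ⟨ha, i, hi⟩
    have main : ∀ u w, f^[u] a = f^[u + w] a → p + 1 ∣ w := by
      intro u w huw
      have h1 : Function.IsPeriodicPt f (p + 1) (f^[u] (f^[i] a)) :=
        Function.IsPeriodicPt.apply_iterate hi u
      have h2 : Function.IsPeriodicPt f w (f^[i] (f^[u] a)) := by
        refine Function.IsPeriodicPt.apply_iterate ?_ i
        rw [Function.IsPeriodicPt, Function.IsFixedPt, ← Function.iterate_add_apply, add_comm]
        exact huw.symm
      rw [← Function.iterate_add_apply] at h1 h2
      rw [add_comm] at h2
      have h3 := hmin _ _ (Nat.gcd_pos_of_pos_left w (Nat.succ_pos p)) (ha.iterate (u + i))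
        (h1.gcd h2)
      have h4 := Nat.le_antisymm (Nat.gcd_le_left w (Nat.succ_pos p)) h3
      exact Nat.gcd_eq_left_iff_dvd.1 h4
    intro u v huv
    rcases le_total u v with h | h
    · obtain ⟨w, rfl⟩ := Nat.exists_eq_add_of_le h
      rw [Nat.cast_add, (ZMod.natCast_eq_zero_iff w (p + 1)).2 (main u w huv), add_zero]
    · obtain ⟨w, rfl⟩ := Nat.exists_eq_add_of_le h
      rw [Nat.cast_add, (ZMod.natCast_eq_zero_iff w (p + 1)).2 (main v w huv.symm), add_zero]
  obtain ⟨l, hl⟩ := exists_zmod_level hKper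
  let E : {a // ¬ K a} → {a // ¬ K a} → Prop := fun a b => Q a b
  have : Fintype {a // ¬ K a} := Fintype.ofFinite _
  obtain ⟨n, hn⟩ : ∃ n, Models (Sum.LiftRel E (Ladder p (p * (n + 1)) false)) φ := by
    refine exists_models_ladder E hp fun n => (hφ _ inferInstance _).2 fun D hD => ?_
    obtain ⟨c, hc0, hc⟩ := ladder_closedWalk (D := fun u v => D (Sum.inr u) (Sum.inr v)) hp
      (Nat.succ_pos n) rfl (fun u v huv => by simpa using hD.1 _ _ huv) fun u v huv => by
        obtain ⟨w, hw⟩ := Repair.exists_edge hD (Sum.LiftRel.inr huv)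
        rcases w with w | w
        · simpa using hD.1 _ _ hw
        · exact ⟨w, hw⟩
    refine ⟨fun a => if ha : K a then Sum.inr (c (l a).val) else Sum.inl ⟨a, ha⟩, ?_⟩
    intro a b hab
    by_cases ha : K a
    · have hb := (hKQ a b hab).2 ha
      simp only [dif_pos ha, dif_pos hb]
      obtain rfl := hf a b hab
      rw [hl a ha]
      have hlt := ZMod.val_lt (l a)
      have hval : c (l a + 1).val = c ((l a).val + 1) := by
        rw [ZMod.val_add, ZMod.val_one'' (by omega)]
        rcases Nat.lt_or_ge ((l a).val + 1) (p + 1) with h | h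
        · rw [Nat.mod_eq_of_lt h]
        · have : (l a).val + 1 = p + 1 := by omega
          rw [this, Nat.mod_self, hc0]
      rw [hval]
      exact hc _ hlt
    · have hb := fun h => ha ((hKQ a b hab).1 h)
      simp only [dif_neg ha, dif_neg hb]
      obtain ⟨w, hw⟩ := Repair.exists_edge hD (a := Sum.inl ⟨a, ha⟩) (b := Sum.inl ⟨b, hb⟩)
        (Sum.LiftRel.inl hab)
      rcases w with w | w
      · have hEw : Q a w := by simpa [E] using hD.1 _ _ hw
        have : w = ⟨b, hb⟩ := Subtype.ext ((hf _ _ hEw).symm.trans (hf _ _ hab))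
        rwa [this] at hw
      · simpa using hD.1 _ _ hw
  have hrep : Repair (Sum.LiftRel E (Ladder p (p * (n + 1)) false))
      (Sum.LiftRel E (LadderRepair p (p * (n + 1)))) := by
    refine repair_of_total ?_ ?_ ?_
    · rintro _ _ (h | h)
      · exact Sum.LiftRel.inl h
      · exact Sum.LiftRel.inr h.1
    · rintro _ _ _ (h | h) (h' | h')
      · exact congrArg Sum.inl (Subtype.ext ((hf _ _ h).symm.trans (hf _ _ h')))
      · exact congrArg Sum.inr (LadderRepair.consistent _ _ _ _ _ h h')
    · rintro _ _ (h | h)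
      · exact ⟨_, Sum.LiftRel.inl h⟩
      · obtain ⟨w, hw⟩ := LadderRepair.total rfl h
        exact ⟨_, Sum.LiftRel.inr hw⟩
  obtain ⟨h, hh⟩ := (hφ _ inferInstance _).1 hn _ hrep
  rcases hx0 : h x with a | u
  · have hwalk : ∀ i, ∃ hi : ¬ K (f^[i] a), h (f^[i] x) = Sum.inl ⟨f^[i] a, hi⟩ ∧
        Q (f^[i] a) (f^[i + 1] a) := by
      have step : ∀ i (b : {a // ¬ K a}), h (f^[i] x) = Sum.inl b →
          ∃ b' : {a // ¬ K a}, h (f^[i + 1] x) = Sum.inl b' ∧ Q b b' := by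
        intro i b hb
        have := hh _ _ (hx i)
        rw [hb] at this
        rcases hw : h (f^[i + 1] x) with b' | u <;> rw [hw] at this
        · exact ⟨b', rfl, by simpa [E] using this⟩
        · simp at this
      intro i
      induction i with
      | zero =>
        obtain ⟨b', -, hb'⟩ := step 0 a hx0
        exact ⟨a.2, hx0, by simpa [hf _ _ hb'] using hb'⟩
      | succ i ih =>
        obtain ⟨hi, hi', -⟩ := ih
        obtain ⟨b, hb, hbQ⟩ := step i _ hi'
        obtain ⟨b', -, hb'Q⟩ := step (i + 1) b hb
        have e : f^[i + 1] (a : W) = b := by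
          rw [Function.iterate_succ_apply']
          exact hf _ _ hbQ
        have e' : f^[i + 1 + 1] (a : W) = b' := by
          rw [Function.iterate_succ_apply', e]
          exact hf _ _ hb'Q
        rw [e']
        refine ⟨e ▸ b.2, ?_, e ▸ hb'Q⟩
        rw [hb]
        exact congrArg Sum.inl (Subtype.ext e.symm)
    refine a.2 ⟨fun i => (hwalk i).2.2, 0, ?_⟩
    obtain ⟨_, h1, -⟩ := hwalk (p + 1)
    rw [hxk, hx0] at h1
    exact (congrArg Subtype.val (Sum.inl_injective h1)).symm
  · have hwalk : ∀ i, ∃ v, h (f^[i] x) = Sum.inr v ∧ potential p u + i ≤ potential p v := by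
      intro i
      induction i with
      | zero => exact ⟨u, hx0, by simp⟩
      | succ i ih =>
        obtain ⟨v, hv, hle⟩ := ih
        have := hh _ _ (hx i)
        rw [hv] at this
        rcases hw : h (f^[i + 1] x) with b' | w <;> rw [hw] at this
        · simp at this
        · rw [Sum.liftRel_inr_inr] at this
          refine ⟨w, rfl, ?_⟩
          have := this.potential_lt hp
          push_cast
          omega
    obtain ⟨v, hv, hle⟩ := hwalk (p + 1)
    rw [hxk, hx0] at hv
    rw [Sum.inr_injective hv] at hle
    push_cast at hle
    omega

end Hardness

section Chase

variable {W : Type}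

/-- Elements identified by every homomorphism from `Q` to a finite consistent relation. -/
def chaseSetoid (Q : W → W → Prop) : Setoid W where
  r a b := ∀ (V : Type) (_ : Fintype V) (D : V → V → Prop), Consistent D →
    ∀ h : W → V, (∀ x y, Q x y → D (h x) (h y)) → h a = h b
  iseqv :=
    ⟨fun _ _ _ _ _ _ _ => rfl, fun H V i D hD h hh => (H V i D hD h hh).symm,
      fun H H' V i D hD h hh => (H V i D hD h hh).trans (H' V i D hD h hh)⟩

/-- The relation induced by `Q` on the quotient by `chaseSetoid Q`. -/
def chase (Q : W → W → Prop) (x y : Quotient (chaseSetoid Q)) : Prop :=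
  ∃ a b, Quotient.mk _ a = x ∧ Quotient.mk _ b = y ∧ Q a b

theorem consistent_chase (Q : W → W → Prop) : Consistent (chase Q) := by
  rintro _ _ _ ⟨a, b, rfl, rfl, hab⟩ ⟨a', b', haa, rfl, hab'⟩
  refine Quotient.sound fun V i D hD h hh => ?_
  have := Quotient.exact haa V i D hD h hh
  exact hD _ _ _ (hh _ _ hab) (this ▸ hh _ _ hab')

theorem hasHom_chase_iff {Q : W → W → Prop} {V : Type} [i : Fintype V] {D : V → V → Prop}
    (hD : Consistent D) : HasHom (chase Q) D ↔ HasHom Q D := by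
  constructor
  · rintro ⟨h, hh⟩
    exact ⟨fun a => h (Quotient.mk _ a), fun a b hab => hh _ _ ⟨a, b, rfl, rfl, hab⟩⟩
  · rintro ⟨h, hh⟩
    refine ⟨Quotient.lift h fun a b hab => hab V i D hD h hh, ?_⟩
    rintro _ _ ⟨a, b, rfl, rfl, hab⟩
    exact hh a b hab

end Chase

section Classification

variable {W : Type} {Q : W → W → Prop}

theorem hasHom_iff_loop {a : W} (ha : Q a a) {V : Type} {D : V → V → Prop} :
    HasHom Q D ↔ ∃ a, D a a :=
  ⟨fun ⟨h, hh⟩ => ⟨h a, hh a a ha⟩, fun ⟨b, hb⟩ => ⟨fun _ => b, fun _ _ _ => hb⟩⟩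

theorem exists_hasHom_iff_walk [Finite W] {f : W → W} (hf : ∀ a b, Q a b → f a = b)
    (hQ : ∃ a b, Q a b) (hfin : ∀ a, ¬ InfiniteWalk Q f a) :
    ∃ n, 1 ≤ n ∧ ∀ (V : Type) (D : V → V → Prop),
      HasHom Q D ↔ ∃ g : Fin (n + 1) → V, IsWalk D n g := by
  classical
  have hex : ∀ a, ∃ i, ¬ Q (f^[i] a) (f^[i + 1] a) := fun a => not_forall.1 (hfin a)
  let r : W → ℕ := fun a => Nat.find (hex a)
  have hr : ∀ a b, Q a b → r a = r b + 1 := by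
    intro a b hab
    obtain rfl := hf a b hab
    exact Nat.find_comp_succ (hex a) (hex (f a)) (not_not.2 hab)
  obtain ⟨a, b, hab⟩ := hQ
  have : Nonempty W := ⟨a⟩
  obtain ⟨m, hm⟩ := Finite.exists_max r
  refine ⟨r m, by have := hm a; have := hr a b hab; omega, fun V D => ⟨?_, ?_⟩⟩
  · rintro ⟨h, hh⟩
    refine ⟨fun i => h (f^[i] m), fun i => hh _ _ ?_⟩
    exact not_not.1 (Nat.find_min (hex m) i.2)
  · rintro ⟨g, hg⟩
    refine ⟨fun a => g ⟨r m - r a, by omega⟩, fun a b hab => ?_⟩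
    have h1 := hr a b hab
    have h2 := hm a
    have hsucc : (⟨r m - r b, by omega⟩ : Fin (r m + 1)) = Fin.succ ⟨r m - r a, by omega⟩ :=
      Fin.ext (by simp only [Fin.val_succ]; omega)
    simp only [hsucc]
    exact hg ⟨r m - r a, by omega⟩

theorem exists_closedWalk [Finite W] {f : W → W} {a : W} (ha : InfiniteWalk Q f a) :
    ∃ k, 1 ≤ k ∧ ∃ x, InfiniteWalk Q f x ∧ f^[k] x = x := by
  obtain ⟨i, j, hij, heq⟩ := Finite.exists_ne_map_eq_of_infinite fun n : ℕ => f^[n] a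
  wlog hlt : i < j generalizing i j
  · exact this j i hij.symm heq.symm (by omega)
  refine ⟨j - i, by omega, f^[i] a, ha.iterate i, ?_⟩
  rw [← Function.iterate_add_apply, Nat.sub_add_cancel hlt.le]
  exact heq.symm

theorem path_or_loop_of_consistent [Finite W] (hc : Consistent Q) (hQ : ∃ a b, Q a b)
    {φ : Language.graph.Sentence}
    (hφ : ∀ (V : Type) (_ : Fintype V) (R : V → V → Prop),
      Models R φ ↔ ∀ D : V → V → Prop, Repair R D → HasHom Q D) :
    (∃ n, 1 ≤ n ∧ ∀ (V : Type) (D : V → V → Prop),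
      HasHom Q D ↔ ∃ g : Fin (n + 1) → V, IsWalk D n g) ∨
    ∀ (V : Type) (D : V → V → Prop), HasHom Q D ↔ ∃ a, D a a := by
  classical
  let f : W → W := fun a => if h : ∃ b, Q a b then h.choose else a
  have hf : ∀ a b, Q a b → f a = b := by
    intro a b hab
    have h : ∃ b, Q a b := ⟨b, hab⟩
    simp only [f, dif_pos h]
    exact hc _ _ _ h.choose_spec hab
  by_cases hfin : ∀ a, ¬ InfiniteWalk Q f a
  · exact Or.inl (exists_hasHom_iff_walk hf hQ hfin)
  · push Not at hfin
    obtain ⟨a, ha⟩ := hfin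
    have hex := exists_closedWalk ha
    obtain ⟨hk, x, hx, hxk⟩ := Nat.find_spec hex
    rcases hk.eq_or_lt with h1 | h1
    · rw [← h1] at hxk
      refine Or.inr fun V D => hasHom_iff_loop (a := x) ?_
      have := hx 0
      rwa [zero_add, hxk] at this
    · exact absurd hφ (not_rewritable hf h1 hx hxk
        (fun j y hj hy hyj => Nat.find_min' hex ⟨hj, y, hy, hyj⟩) φ)

end Classification

end KeyRepair

theorem stmt15 {W : Type} [Fintype W] [Nonempty W] (Q : W → W → Prop)
    (hQ : ∃ a b, Q a b) :
    (∃ φ : Language.graph.Sentence,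
      ∀ (V : Type) (_ : Fintype V) (R : V → V → Prop),
        (@FirstOrder.Language.Sentence.Realize Language.graph V (relStructure R) φ) ↔
        (∀ D : V → V → Prop, Repair R D → ∃ h : W → V, ∀ a b, Q a b → D (h a) (h b))) ↔
    ((∃ n : ℕ, 1 ≤ n ∧ ∀ (V : Type) (_ : Fintype V) (D : V → V → Prop), Consistent D →
        ((∃ h : W → V, ∀ a b, Q a b → D (h a) (h b)) ↔ ∃ f : Fin (n + 1) → V, IsWalk D n f)) ∨
      (∀ (V : Type) (_ : Fintype V) (D : V → V → Prop), Consistent D →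
        ((∃ h : W → V, ∀ a b, Q a b → D (h a) (h b)) ↔ ∃ a : V, D a a))) := by
  open KeyRepair in
  constructor
  · rintro ⟨φ, hφ⟩
    obtain ⟨a, b, hab⟩ := hQ
    have key := path_or_loop_of_consistent (consistent_chase Q)
      ⟨_, _, a, b, rfl, rfl, hab⟩ (φ := φ) fun V i R => (hφ V i R).trans <|
        forall₂_congr fun D hD => (hasHom_chase_iff hD.2.1).symm
    refine key.imp (fun ⟨n, hn, h⟩ => ⟨n, hn, fun V i D hD => ?_⟩) fun h V i D hD => ?_
    · exact (hasHom_chase_iff hD).symm.trans (h V D)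
    · exact (hasHom_chase_iff hD).symm.trans (h V D)
  · rintro (⟨n, -, h⟩ | h)
    · refine ⟨forcedSentence n, fun V i R => (models_forcedSentence R n).trans ?_⟩
      rw [← walk_in_repairs_iff]
      exact forall₂_congr fun D hD => (h V i D hD.2.1).symm
    · refine ⟨loopSentence, fun V i R => (models_loopSentence R).trans ?_⟩
      rw [← loop_in_repairs_iff]
      exact forall₂_congr fun D hD => (h V i D hD.2.1).symm
end
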